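/- Let 1/2 < μ < 4d. There exist a finite length L_*(μ) and a constant α(μ) > 0 such that for all even L ≥ L_*(μ) and all subsets Ω ⊆ Λ, the eigenvalue-sum difference satisfies δE(μ,Ω) := Tr{[-Δ̃ - μ·Id]_-} - Tr{[-Δ - μ·Id]_-} ≥ α(μ)·|∂Ω|, where Δ̃ := P_Ω Δ P_Ω + P_Ω^⊥ Δ P_Ω^⊥. -/

import Mathlib

open Matrix
open scoped BigOperators Classical ComplexOrder

noncomputable section

/-- The discrete torus `Λ = (ℤ/Lℤ)^d`. -/
abbrev Lam (d L : ℕ) : Type := Fin d → ZMod L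

/-- `x` and `y` are nearest neighbors on the torus (ℓ¹-distance 1). -/
def isNN {d L : ℕ} (x y : Lam d L) : Prop :=
  ∃ ν : Fin d, (x ν = y ν + 1 ∨ x ν + 1 = y ν) ∧ ∀ μ : Fin d, μ ≠ ν → x μ = y μ

/-- The discrete Laplacian `Δ = T - 2d·Id` on the torus. -/
def lap (d L : ℕ) : Matrix (Lam d L) (Lam d L) ℂ :=
  (Matrix.of fun x y => if isNN x y then (1 : ℂ) else 0) - (2 * (d : ℂ)) • 1

/-- A one-particle density matrix: hermitian with `0 ≤ γ ≤ 1` as quadratic forms. -/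
def IsDM {d L : ℕ} [NeZero L] (γ : Matrix (Lam d L) (Lam d L) ℂ) : Prop :=
  γ.PosSemidef ∧ (1 - γ).PosSemidef

/-- `Tr{[X]_-}`: the sum of the negative eigenvalues of a hermitian matrix `X`
(junk value `0` if `X` is not hermitian). -/
def negTrace {n : Type} [Fintype n] [DecidableEq n] (X : Matrix n n ℂ) : ℝ :=
  if hX : X.IsHermitian then ∑ i, min (hX.eigenvalues i) 0 else 0

/-- The HFz energy functional. -/
def hfzE {d L : ℕ} [NeZero L] (μ U : ℝ) (γu γd : Matrix (Lam d L) (Lam d L) ℂ) : ℝ :=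
  (((-(lap d L) - (μ : ℂ) • 1) * (γu + γd)).trace).re
    + U * ∑ x, (γu x x).re * (γd x x).re

/-- The set of HFz energy values over pairs of one-particle density matrices. -/
def hfzEnergies (d L : ℕ) [NeZero L] (μ U : ℝ) : Set ℝ :=
  { E | ∃ γu γd : Matrix (Lam d L) (Lam d L) ℂ, IsDM γu ∧ IsDM γd ∧ hfzE μ U γu γd = E }

/-- The diagonal orthogonal projection `P_A` onto the coordinates in `A`. -/
def proj {d L : ℕ} (A : Set (Lam d L)) : Matrix (Lam d L) (Lam d L) ℂ :=
  Matrix.diagonal fun x => if x ∈ A then 1 else 0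

/-- The boundary `∂Ω := {x ∈ Ω : x has a nearest neighbor outside Ω}`. -/
def bdry {d L : ℕ} (Ω : Set (Lam d L)) : Set (Lam d L) :=
  {x | x ∈ Ω ∧ ∃ y, y ∉ Ω ∧ isNN x y}

theorem norm_trace_mul_sq_le {n : Type*} [Fintype n] (A B : Matrix n n ℂ) :
    ‖(A * B).trace‖ ^ 2 ≤ (∑ i, ∑ j, ‖A i j‖ ^ 2) * ∑ i, ∑ j, ‖B i j‖ ^ 2 := by
  have h1 : ‖(A * B).trace‖ ≤ ∑ x : n × n, ‖A x.1 x.2‖ * ‖B x.2 x.1‖ := by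
    simp only [Matrix.trace, Matrix.diag, Matrix.mul_apply, Fintype.sum_prod_type]
    refine (norm_sum_le _ _).trans (Finset.sum_le_sum fun i _ => ?_)
    refine (norm_sum_le _ _).trans (Finset.sum_le_sum fun j _ => ?_)
    rw [norm_mul]
  calc ‖(A * B).trace‖ ^ 2 ≤ (∑ x : n × n, ‖A x.1 x.2‖ * ‖B x.2 x.1‖) ^ 2 := by gcongr
    _ ≤ (∑ x : n × n, ‖A x.1 x.2‖ ^ 2) * ∑ x : n × n, ‖B x.2 x.1‖ ^ 2 :=
        Finset.sum_mul_sq_le_sq_mul_sq _ _ _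
    _ = _ := by
        simp only [Fintype.sum_prod_type]
        rw [Finset.sum_comm (f := fun i j => ‖B j i‖ ^ 2)]

theorem sum_norm_sq_row {n : Type*} [Fintype n] (A : Matrix n n ℂ) (i : n) :
    ∑ j, ‖A i j‖ ^ 2 = ((A * Aᴴ) i i).re := by
  simp only [Matrix.mul_apply, Matrix.conjTranspose_apply, Complex.re_sum]
  refine Finset.sum_congr rfl fun j _ => ?_
  rw [← Complex.normSq_eq_norm_sq]
  simp [Complex.normSq_apply]

theorem posSemidef_one_sub_proj {n : Type*} [Fintype n] [DecidableEq n] {P : Matrix n n ℂ}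
    (hP : P.IsHermitian) (hPP : P * P = P) : (1 - P).PosSemidef := by
  have h : (1 - P) = (1 - P)ᴴ * 1 * (1 - P) := by
    rw [Matrix.conjTranspose_sub, hP.eq, Matrix.conjTranspose_one]
    noncomm_ring [hPP]
  rw [h]
  exact Matrix.PosSemidef.one.conjTranspose_mul_mul_same _

/-- Sandwiching a projection between two copies of a density matrix decreases it. -/
theorem posSemidef_sub_mul_proj_mul {n : Type*} [Fintype n] [DecidableEq n]
    {P G : Matrix n n ℂ} (hP : P.IsHermitian) (hPP : P * P = P)
    (hG : G.PosSemidef) (hG1 : (1 - G).PosSemidef) : (G - G * P * G).PosSemidef := by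
  have h : G - G * P * G = Gᴴ * (1 - P) * G + (Gᴴ * (1 - G) * G + (1 - G)ᴴ * G * (1 - G)) := by
    rw [hG.isHermitian.eq, hG1.isHermitian.eq]
    noncomm_ring
  rw [h]
  exact ((posSemidef_one_sub_proj hP hPP).conjTranspose_mul_mul_same G).add
    ((hG1.conjTranspose_mul_mul_same G).add (hG.conjTranspose_mul_mul_same (1 - G)))

theorem norm_trace_diagonal_proj_le {n : Type*} [Fintype n] [DecidableEq n]
    {P G : Matrix n n ℂ} (hP : P.IsHermitian) (hPP : P * P = P)
    (hG : G.PosSemidef) (hG1 : (1 - G).PosSemidef)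
    {h g : n → ℝ} {M : ℝ} (hM0 : 0 ≤ M) (h0 : ∀ k, 0 ≤ h k)
    (hM : ∀ k, h k ≤ M) (hg : ∀ k, h k * g k = 0) :
    ‖(Matrix.diagonal (fun k => (h k : ℂ)) * G * P * Matrix.diagonal (fun k => (g k : ℂ))
        * P).trace‖ ^ 2
      ≤ (M * ∑ k, h k * (G k k).re) * ∑ k, ∑ l, (g k - g l) ^ 2 * ‖P k l‖ ^ 2 := by
  set Dh := Matrix.diagonal (fun k => (h k : ℂ)) with hDh
  set Dg := Matrix.diagonal (fun k => (g k : ℂ)) with hDg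
  have hgh : Dg * Dh = 0 := by
    rw [hDh, hDg, Matrix.diagonal_mul_diagonal, ← Matrix.diagonal_zero]
    congr 1
    funext k
    rw [mul_comm]
    exact_mod_cast hg k
  have hz : (Dh * G * P * (P * Dg)).trace = 0 := by
    rw [← mul_assoc, Matrix.trace_mul_comm, ← mul_assoc, ← mul_assoc, ← mul_assoc, hgh]
    simp
  have heq : (Dh * G * P * Dg * P).trace = ((Dh * G * P) * (Dg * P - P * Dg)).trace := by
    rw [mul_sub, Matrix.trace_sub, hz, sub_zero, mul_assoc (Dh * G * P)]
  rw [heq]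
  refine (norm_trace_mul_sq_le _ _).trans ?_
  refine mul_le_mul ?_ (le_of_eq ?_) (by positivity) ?_
  · rw [Finset.mul_sum]
    refine Finset.sum_le_sum fun k _ => ?_
    have hrow : ∑ j, ‖(Dh * G * P) k j‖ ^ 2 = h k ^ 2 * ((G * P * G) k k).re := by
      have : G * P * G = (G * P) * (G * P)ᴴ := by
        rw [Matrix.conjTranspose_mul, hP.eq, hG.isHermitian.eq, mul_assoc G P (P * G),
          ← mul_assoc P P, hPP, mul_assoc]
      rw [this, ← sum_norm_sq_row, Finset.mul_sum]
      refine Finset.sum_congr rfl fun j _ => ?_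
      rw [mul_assoc Dh, hDh, Matrix.diagonal_mul, norm_mul, mul_pow, Complex.norm_real,
        Real.norm_eq_abs, sq_abs]
    rw [hrow]
    have hle : ((G * P * G) k k).re ≤ (G k k).re := by
      have := (Complex.le_def.1
        ((posSemidef_sub_mul_proj_mul hP hPP hG hG1).diag_nonneg (i := k))).1
      simpa using this
    have hGk : 0 ≤ (G k k).re := (Complex.le_def.1 (hG.diag_nonneg (i := k))).1
    calc h k ^ 2 * ((G * P * G) k k).re ≤ h k ^ 2 * (G k k).re := by gcongr
      _ = h k * (h k * (G k k).re) := by ring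
      _ ≤ M * (h k * (G k k).re) := by
        have := h0 k
        have := hM k
        gcongr
  · refine Finset.sum_congr rfl fun k _ => Finset.sum_congr rfl fun l _ => ?_
    rw [Matrix.sub_apply, hDg, Matrix.diagonal_mul, Matrix.mul_diagonal]
    rw [show (g k : ℂ) * P k l - P k l * (g l : ℂ) = ((g k - g l : ℝ) : ℂ) * P k l by
      push_cast; ring]
    rw [norm_mul, mul_pow, Complex.norm_real, Real.norm_eq_abs, sq_abs]
  · exact mul_nonneg hM0 (Finset.sum_nonneg fun k _ =>
      mul_nonneg (h0 k) (Complex.le_def.1 (hG.diag_nonneg (i := k))).1)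

/-- If a density matrix `G` commutes with a projection `P`, its excess energy over the Fermi sea
of the diagonal Hamiltonian `E` controls the coupling by `P` of positive to negative energies. -/
theorem sq_coupling_le_excess_mul {n : Type*} [Fintype n] [DecidableEq n] {P G : Matrix n n ℂ}
    (hP : P.IsHermitian) (hPP : P * P = P)
    (hG : G.PosSemidef) (hG1 : (1 - G).PosSemidef) (hPG : P * G = G * P)
    {E : n → ℝ} {M : ℝ} (hM0 : 0 ≤ M) (hM : ∀ k, |E k| ≤ M) :
    (∑ k, ∑ l, max (E k) 0 * max (-E l) 0 * ‖P k l‖ ^ 2) ^ 2 ≤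
      2 * M * (∑ k, (E k * (G k k).re - min (E k) 0))
        * ∑ k, ∑ l, (E k - E l) ^ 2 * ‖P k l‖ ^ 2 := by
  set p : n → ℝ := fun k => max (E k) 0 with hp
  set m : n → ℝ := fun k => max (-E k) 0 with hm
  have hpm : ∀ k, p k * m k = 0 := by
    intro k
    simp only [hp, hm]
    rcases le_total (E k) 0 with h | h
    · rw [max_eq_right h, zero_mul]
    · rw [max_eq_right (neg_nonpos.2 h), mul_zero]
  have h1 := norm_trace_diagonal_proj_le hP hPP hG hG1 (h := p) (g := m) (M := M) hM0
    (fun k => le_max_right _ _) (fun k => max_le ((le_abs_self _).trans (hM k)) hM0) hpm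
  have h2 := norm_trace_diagonal_proj_le hP hPP hG1 (by simpa using hG) (h := m) (g := p)
    (M := M) hM0 (fun k => le_max_right _ _) (fun k => max_le ((neg_le_abs _).trans (hM k)) hM0)
    (fun k => by rw [mul_comm]; exact hpm k)
  set N := ∑ k, ∑ l, (E k - E l) ^ 2 * ‖P k l‖ ^ 2 with hN
  have hNm : ∑ k, ∑ l, (m k - m l) ^ 2 * ‖P k l‖ ^ 2 ≤ N := by
    refine Finset.sum_le_sum fun k _ => Finset.sum_le_sum fun l _ => ?_
    refine mul_le_mul_of_nonneg_right (sq_le_sq.2 ?_) (by positivity)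
    calc |m k - m l| ≤ |-E k - -E l| := abs_max_sub_max_le_abs _ _ _
      _ = |E k - E l| := by rw [← abs_neg]; congr 1; ring
  have hNp : ∑ k, ∑ l, (p k - p l) ^ 2 * ‖P k l‖ ^ 2 ≤ N := by
    refine Finset.sum_le_sum fun k _ => Finset.sum_le_sum fun l _ => ?_
    exact mul_le_mul_of_nonneg_right (sq_le_sq.2 (abs_max_sub_max_le_abs _ _ _)) (by positivity)
  set Dp := Matrix.diagonal (fun k => (p k : ℂ)) with hDp
  set Dm := Matrix.diagonal (fun k => (m k : ℂ)) with hDm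
  have hDpH : Dpᴴ = Dp := by
    rw [hDp, Matrix.diagonal_conjTranspose]; congr 1; funext k; simp
  have hDmH : Dmᴴ = Dm := by
    rw [hDm, Matrix.diagonal_conjTranspose]; congr 1; funext k; simp
  have hS : ((∑ k, ∑ l, p k * m l * ‖P k l‖ ^ 2 : ℝ) : ℂ) = (Dp * P * Dm * P).trace := by
    simp only [Matrix.trace, Matrix.diag]
    push_cast
    refine Finset.sum_congr rfl fun k _ => ?_
    rw [Matrix.mul_apply]
    refine Finset.sum_congr rfl fun l _ => ?_
    rw [hDm, Matrix.mul_diagonal, hDp, Matrix.diagonal_mul, ← hP.apply l k,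
      ← Complex.mul_conj']
    simp only [RCLike.star_def]
    ring
  have hsplit : (Dp * P * Dm * P).trace =
      (Dp * G * P * Dm * P).trace + star (Dm * (1 - G) * P * Dp * P).trace := by
    rw [← Matrix.trace_conjTranspose]
    simp only [Matrix.conjTranspose_mul, hDpH, hDmH, hP.eq, hG1.isHermitian.eq]
    rw [Matrix.trace_mul_comm P, ← Matrix.trace_add]
    congr 1
    rw [mul_assoc Dp G, ← hPG]
    noncomm_ring
  have hnorm : ‖(Dp * P * Dm * P).trace‖ ≤
      ‖(Dp * G * P * Dm * P).trace‖ + ‖(Dm * (1 - G) * P * Dp * P).trace‖ := by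
    rw [hsplit]
    exact (norm_add_le _ _).trans (by rw [norm_star])
  rw [← hS, Complex.norm_real, Real.norm_eq_abs] at hnorm
  set S := ∑ k, ∑ l, p k * m l * ‖P k l‖ ^ 2
  set a := ‖(Dp * G * P * Dm * P).trace‖
  set b := ‖(Dm * (1 - G) * P * Dp * P).trace‖
  have ha0 : 0 ≤ ∑ k, p k * (G k k).re := Finset.sum_nonneg fun k _ =>
    mul_nonneg (le_max_right _ _) (Complex.le_def.1 (hG.diag_nonneg (i := k))).1
  have hb0 : 0 ≤ ∑ k, m k * ((1 - G) k k).re := Finset.sum_nonneg fun k _ =>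
    mul_nonneg (le_max_right _ _) (Complex.le_def.1 (hG1.diag_nonneg (i := k))).1
  have ha : a ^ 2 ≤ (M * ∑ k, p k * (G k k).re) * N := h1.trans (by gcongr)
  have hb : b ^ 2 ≤ (M * ∑ k, m k * ((1 - G) k k).re) * N := h2.trans (by gcongr)
  have hδ : ∑ k, (E k * (G k k).re - min (E k) 0) =
      ∑ k, p k * (G k k).re + ∑ k, m k * ((1 - G) k k).re := by
    rw [← Finset.sum_add_distrib]
    refine Finset.sum_congr rfl fun k _ => ?_
    simp only [hp, hm, Matrix.sub_apply, Matrix.one_apply_eq, Complex.sub_re, Complex.one_re]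
    rcases le_total (E k) 0 with h | h
    · rw [max_eq_right h, min_eq_left h, max_eq_left (neg_nonneg.2 h)]; ring
    · rw [max_eq_left h, min_eq_right h, max_eq_right (neg_nonpos.2 h)]; ring
  rw [hδ]
  have : S ^ 2 ≤ (a + b) ^ 2 := by
    rw [← sq_abs S]
    gcongr
  nlinarith [sq_nonneg (a - b)]

theorem posSemidef_conj_indicator {n : Type*} [Fintype n] [DecidableEq n] {U : Matrix n n ℂ}
    (hU : U * Uᴴ = 1) (e : n → ℝ) :
    (U * Matrix.diagonal (fun i => if e i < 0 then (1 : ℂ) else 0) * Uᴴ).PosSemidef ∧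
      (1 - U * Matrix.diagonal (fun i => if e i < 0 then (1 : ℂ) else 0) * Uᴴ).PosSemidef := by
  constructor
  · refine Matrix.PosSemidef.mul_mul_conjTranspose_same (.diagonal fun i => ?_) U
    rw [Pi.zero_apply]
    split_ifs <;> simp
  · have : 1 - U * Matrix.diagonal (fun i => if e i < 0 then (1 : ℂ) else 0) * Uᴴ =
        U * Matrix.diagonal (fun i => 1 - if e i < 0 then (1 : ℂ) else 0) * Uᴴ := by
      rw [← Matrix.diagonal_sub, Matrix.diagonal_one, mul_sub, sub_mul, mul_one, hU]
    rw [this]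
    refine Matrix.PosSemidef.mul_mul_conjTranspose_same (.diagonal fun i => ?_) U
    rw [Pi.zero_apply]
    split_ifs <;> simp

theorem negTrace_le_re_trace {n : Type} [Fintype n] [DecidableEq n] {X G : Matrix n n ℂ}
    (hX : X.IsHermitian) (hG : G.PosSemidef) (hG1 : (1 - G).PosSemidef) :
    negTrace X ≤ ((X * G).trace).re := by
  rw [negTrace, dif_pos hX]
  set U : Matrix n n ℂ := (hX.eigenvectorUnitary : Matrix n n ℂ)
  set D : Matrix n n ℂ := Matrix.diagonal (RCLike.ofReal ∘ hX.eigenvalues)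
  have hUU : Uᴴ * U = 1 := Unitary.coe_star_mul_self hX.eigenvectorUnitary
  have hsp : X = U * D * Uᴴ := by
    conv_lhs => rw [hX.spectral_theorem, Unitary.conjStarAlgAut_apply]
    rfl
  have h0 := hG.conjTranspose_mul_mul_same U
  have h1 := hG1.conjTranspose_mul_mul_same U
  rw [mul_sub, sub_mul, mul_one, hUU] at h1
  have htr : (X * G).trace = (D * (Uᴴ * G * U)).trace := by
    rw [hsp, mul_assoc, mul_assoc, Matrix.trace_mul_comm, mul_assoc]
  rw [htr, Matrix.trace, Complex.re_sum]
  refine Finset.sum_le_sum fun i _ => ?_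
  rw [Matrix.diag_apply, Matrix.diagonal_mul]
  have e0 : 0 ≤ ((Uᴴ * G * U) i i).re := (Complex.le_def.1 (h0.diag_nonneg (i := i))).1
  have e1 : 0 ≤ ((1 - Uᴴ * G * U) i i).re := (Complex.le_def.1 (h1.diag_nonneg (i := i))).1
  rw [Matrix.sub_apply, Matrix.one_apply_eq, Complex.sub_re, Complex.one_re] at e1
  have hmul : ((RCLike.ofReal ∘ hX.eigenvalues) i * (Uᴴ * G * U) i i : ℂ).re
      = hX.eigenvalues i * ((Uᴴ * G * U) i i).re := Complex.re_ofReal_mul _ _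
  rw [hmul]
  rcases le_total (hX.eigenvalues i) 0 with h | h
  · rw [min_eq_left h]; nlinarith
  · rw [min_eq_right h]; positivity

theorem exists_negTrace_eq_re_trace {n : Type} [Fintype n] [DecidableEq n] {X : Matrix n n ℂ}
    (hX : X.IsHermitian) :
    ∃ G : Matrix n n ℂ, G.PosSemidef ∧ (1 - G).PosSemidef ∧ negTrace X = ((X * G).trace).re := by
  set U : Matrix n n ℂ := (hX.eigenvectorUnitary : Matrix n n ℂ)
  set D : Matrix n n ℂ := Matrix.diagonal (RCLike.ofReal ∘ hX.eigenvalues)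
  have hUU : Uᴴ * U = 1 := Unitary.coe_star_mul_self hX.eigenvectorUnitary
  have hUU' : U * Uᴴ = 1 := Unitary.coe_mul_star_self hX.eigenvectorUnitary
  have hsp : X = U * D * Uᴴ := by
    conv_lhs => rw [hX.spectral_theorem, Unitary.conjStarAlgAut_apply]
    rfl
  set c : n → ℂ := fun i => if hX.eigenvalues i < 0 then 1 else 0
  obtain ⟨hc0, hc1⟩ := posSemidef_conj_indicator hUU' hX.eigenvalues
  refine ⟨U * Matrix.diagonal c * Uᴴ, hc0, hc1, ?_⟩
  · have htr : (X * (U * Matrix.diagonal c * Uᴴ)).trace = (D * Matrix.diagonal c).trace := by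
      rw [hsp, Matrix.trace_mul_comm]
      calc (U * Matrix.diagonal c * Uᴴ * (U * D * Uᴴ)).trace
          = (U * (Matrix.diagonal c * (Uᴴ * U) * D * Uᴴ)).trace := by simp only [mul_assoc]
        _ = (Matrix.diagonal c * D).trace := by
          rw [Matrix.trace_mul_comm, hUU, mul_one, mul_assoc, hUU, mul_one]
        _ = _ := Matrix.trace_mul_comm _ _
    rw [htr, negTrace, dif_pos hX, Matrix.diagonal_mul_diagonal, Matrix.trace_diagonal,
      Complex.re_sum]
    refine Finset.sum_congr rfl fun i _ => ?_
    simp only [c, Function.comp_apply]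
    split_ifs with h
    · rw [min_eq_left h.le, mul_one]; rfl
    · rw [min_eq_right (not_lt.1 h), mul_zero]; rfl

/-- Pinching by a projection raises the negative trace at least by the excess energy of some
density matrix commuting with the projection. -/
theorem exists_excess_le_negTrace_sub {n : Type} [Fintype n] [DecidableEq n]
    {H P F : Matrix n n ℂ} {E : n → ℝ} (hP : P.IsHermitian) (hPP : P * P = P)
    (hF : Fᴴ * F = 1) (hH : H = F * Matrix.diagonal (fun k => (E k : ℂ)) * Fᴴ) :
    ∃ G : Matrix n n ℂ, G.PosSemidef ∧ (1 - G).PosSemidef ∧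
      (Fᴴ * P * F) * G = G * (Fᴴ * P * F) ∧
      ∑ k, (E k * (G k k).re - min (E k) 0) ≤
        negTrace (P * H * P + (1 - P) * H * (1 - P)) - negTrace H := by
  have hF' : F * Fᴴ = 1 := mul_eq_one_comm.1 hF
  have hHh : H.IsHermitian := by
    rw [hH]
    refine Matrix.isHermitian_mul_mul_conjTranspose _ ?_
    refine Matrix.isHermitian_diagonal_of_self_adjoint _ (funext fun k => ?_)
    simp
  have hQ : (1 - P).IsHermitian := Matrix.isHermitian_one.sub hP
  have hPH : (P * H * P + (1 - P) * H * (1 - P)).IsHermitian := by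
    refine Matrix.IsHermitian.add ?_ ?_
    · have := Matrix.isHermitian_mul_mul_conjTranspose P hHh
      rwa [hP.eq] at this
    · have := Matrix.isHermitian_mul_mul_conjTranspose (1 - P) hHh
      rwa [hQ.eq] at this
  obtain ⟨G0, hG0, hG01, hneg⟩ := exists_negTrace_eq_re_trace hPH
  obtain ⟨G1, hG1⟩ : ∃ G1, G1 = P * G0 * P + (1 - P) * G0 * (1 - P) := ⟨_, rfl⟩
  have hQQ : (1 - P) * (1 - P) = 1 - P := by
    rw [mul_sub, sub_mul, sub_mul, hPP]; simp
  have hPQ : P * (1 - P) = 0 := by simp [mul_sub, hPP]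
  have hQP : (1 - P) * P = 0 := by simp [sub_mul, hPP]
  have pinch : ∀ A : Matrix n n ℂ, A.PosSemidef →
      (P * A * P + (1 - P) * A * (1 - P)).PosSemidef := fun A hA => by
    have h1 := hA.mul_mul_conjTranspose_same P
    have h2 := hA.mul_mul_conjTranspose_same (1 - P)
    rw [hP.eq] at h1
    rw [hQ.eq] at h2
    exact h1.add h2
  have hG1pos : G1.PosSemidef := hG1 ▸ pinch _ hG0
  have hG1one : (1 - G1).PosSemidef := by
    have : 1 - G1 = P * (1 - G0) * P + (1 - P) * (1 - G0) * (1 - P) := by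
      rw [hG1, mul_sub P, sub_mul (P * 1), mul_one, hPP, mul_sub (1 - P) 1 G0,
        sub_mul ((1 - P) * 1), mul_one, hQQ]
      abel
    rw [this]
    exact pinch _ hG01
  have hcomm : P * G1 = G1 * P := by
    rw [hG1]
    simp only [mul_add, add_mul]
    simp only [← mul_assoc]
    rw [hPP, hPQ]
    simp only [mul_assoc]
    rw [hPP, hQP]
    simp
  have hGH : ((P * H * P + (1 - P) * H * (1 - P)) * G0).trace = (H * G1).trace := by
    rw [hG1, add_mul, mul_add, Matrix.trace_add, Matrix.trace_add]
    congr 1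
    · rw [mul_assoc, mul_assoc, Matrix.trace_mul_comm]
      simp only [mul_assoc]
    · rw [mul_assoc, mul_assoc, Matrix.trace_mul_comm]
      simp only [mul_assoc]
  have conjF : ∀ A B : Matrix n n ℂ, Fᴴ * A * F * (Fᴴ * B * F) = Fᴴ * (A * B) * F := by
    intro A B
    calc Fᴴ * A * F * (Fᴴ * B * F) = Fᴴ * A * (F * Fᴴ) * B * F := by simp only [mul_assoc]
      _ = _ := by rw [hF', mul_one]; simp only [mul_assoc]
  set c : n → ℂ := fun i => if E i < 0 then 1 else 0 with hc
  obtain ⟨hQ0, hQ1⟩ := posSemidef_conj_indicator hF' E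
  have htrace : ∀ A : Matrix n n ℂ,
      ((H * A).trace).re = ∑ k, E k * ((Fᴴ * A * F) k k).re := by
    intro A
    rw [hH, mul_assoc, mul_assoc, Matrix.trace_mul_comm, mul_assoc, Matrix.trace, Complex.re_sum]
    refine Finset.sum_congr rfl fun k _ => ?_
    rw [Matrix.diag_apply, Matrix.diagonal_mul, Complex.re_ofReal_mul]
  have hlow : negTrace H ≤ ∑ k, min (E k) 0 := by
    refine (negTrace_le_re_trace hHh hQ0 hQ1).trans (le_of_eq ?_)
    rw [htrace]
    refine Finset.sum_congr rfl fun k _ => ?_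
    have : Fᴴ * (F * Matrix.diagonal c * Fᴴ) * F = Matrix.diagonal c := by
      calc _ = (Fᴴ * F) * Matrix.diagonal c * (Fᴴ * F) := by simp only [mul_assoc]
        _ = _ := by rw [hF, one_mul, mul_one]
    rw [this, Matrix.diagonal_apply_eq]
    simp only [hc]
    split_ifs with h
    · simp [h.le]
    · simp [not_lt.1 h]
  refine ⟨Fᴴ * G1 * F, hG1pos.conjTranspose_mul_mul_same F, ?_, ?_, ?_⟩
  · have := hG1one.conjTranspose_mul_mul_same F
    rwa [mul_sub, sub_mul, mul_one, hF] at this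
  · rw [conjF, conjF, hcomm]
  · rw [Finset.sum_sub_distrib, ← htrace, hneg, hGH]
    linarith

/-- If `2u ≤ |q|` modulo `2π`, some angle lies outside the arc `cos > θ` while its translate by
`-q` lies inside, both with a margin that is positive for `u > 0`. -/
theorem exists_cos_margin {θ u : ℝ} (hθ : -1 < θ) (hθ1 : θ < 1) (hu0 : 0 ≤ u)
    (hu : u ≤ Real.arccos θ) (huπ : Real.arccos θ + u ≤ Real.pi) :
    ∃ κ : ℝ, 0 ≤ κ ∧ κ ≤ 1 ∧ (0 < u → 0 < κ) ∧ ∀ q : ℝ, Real.cos q ≤ Real.cos (2 * u) →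
      ∃ k, Real.cos k ≤ θ - κ ∧ θ + κ ≤ Real.cos (k - q) := by
  set τ := Real.arccos θ with hτ
  have hcτ : Real.cos τ = θ := Real.cos_arccos hθ.le hθ1.le
  have hτ0 : 0 < τ := Real.arccos_pos.2 hθ1
  have hτπ : τ ≤ Real.pi := Real.arccos_le_pi θ
  have hA : Real.cos (τ + u) ≤ θ := by
    rw [← hcτ]; exact Real.cos_le_cos_of_nonneg_of_le_pi hτ0.le huπ (by linarith)
  have hB : θ ≤ Real.cos (τ - u) := by
    rw [← hcτ]; exact Real.cos_le_cos_of_nonneg_of_le_pi (by linarith) hτπ (by linarith)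
  obtain ⟨β, hβ0, hβ⟩ : ∃ β : ℝ, 0 < β ∧ (2 * τ ≤ Real.pi → Real.cos (2 * τ) ≤ θ - β) := by
    by_cases h : 2 * τ ≤ Real.pi
    · refine ⟨θ - Real.cos (2 * τ), ?_, fun _ => by linarith⟩
      rw [← hcτ, sub_pos]
      exact Real.cos_lt_cos_of_nonneg_of_le_pi hτ0.le h (by linarith)
    · exact ⟨1, one_pos, fun h' => absurd h' h⟩
  refine ⟨min (min (θ - Real.cos (τ + u)) (Real.cos (τ - u) - θ)) (min (min (1 - θ) β) 1),
    ?_, ?_, ?_, ?_⟩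
  · exact le_min (le_min (by linarith) (by linarith))
      (le_min (le_min (by linarith) hβ0.le) zero_le_one)
  · exact (min_le_right _ _).trans (min_le_right _ _)
  · intro hu1
    refine lt_min (lt_min ?_ ?_) (lt_min (lt_min (by linarith) hβ0) one_pos)
    · rw [← hcτ, sub_pos]
      exact Real.cos_lt_cos_of_nonneg_of_le_pi hτ0.le huπ (by linarith)
    · rw [← hcτ, sub_pos]
      exact Real.cos_lt_cos_of_nonneg_of_le_pi (by linarith) hτπ (by linarith)
  · set κ := min (min (θ - Real.cos (τ + u)) (Real.cos (τ - u) - θ)) (min (min (1 - θ) β) 1)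
    have k1 : κ ≤ θ - Real.cos (τ + u) := (min_le_left _ _).trans (min_le_left _ _)
    have k2 : κ ≤ Real.cos (τ - u) - θ := (min_le_left _ _).trans (min_le_right _ _)
    have k3 : κ ≤ 1 - θ := (min_le_right _ _).trans ((min_le_left _ _).trans (min_le_left _ _))
    have k4 : κ ≤ β := (min_le_right _ _).trans ((min_le_left _ _).trans (min_le_right _ _))
    intro q hq
    set r := Real.arccos (Real.cos q) with hr
    have hcr : Real.cos r = Real.cos q :=
      Real.cos_arccos (Real.neg_one_le_cos q) (Real.cos_le_one q)
    have hr0 : 0 ≤ r := Real.arccos_nonneg _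
    have hrπ : r ≤ Real.pi := Real.arccos_le_pi _
    have hur : 2 * u ≤ r := by
      by_contra! h
      have := Real.cos_lt_cos_of_nonneg_of_le_pi hr0 (by linarith : 2 * u ≤ Real.pi) h
      linarith
    have key : ∃ k, Real.cos k ≤ θ - κ ∧ θ + κ ≤ Real.cos (k - r) := by
      by_cases h : r ≤ 2 * τ
      · refine ⟨τ + u, by linarith, ?_⟩
        have : Real.cos (τ - u) ≤ Real.cos (τ + u - r) := by
          rw [← Real.cos_abs (τ + u - r)]
          exact Real.cos_le_cos_of_nonneg_of_le_pi (abs_nonneg _) (by linarith)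
            (abs_le.2 ⟨by linarith, by linarith⟩)
        linarith
      · push Not at h
        refine ⟨r, ?_, by rw [sub_self, Real.cos_zero]; linarith⟩
        have h1 := hβ (by linarith)
        have h2 := Real.cos_le_cos_of_nonneg_of_le_pi (by linarith : 0 ≤ 2 * τ) hrπ h.le
        linarith
    obtain ⟨k, hk1, hk2⟩ := key
    obtain ⟨n, hn | hn⟩ := Real.cos_eq_cos_iff.1 hcr
    · refine ⟨k, hk1, ?_⟩
      rw [hn, show k - (2 * n * Real.pi + r) = (k - r) - n * (2 * Real.pi) by ring,
        Real.cos_sub_int_mul_two_pi]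
      exact hk2
    · refine ⟨-k, by rwa [Real.cos_neg], ?_⟩
      rw [hn, show -k - (2 * n * Real.pi - r) = -(k - r) - n * (2 * Real.pi) by ring,
        Real.cos_sub_int_mul_two_pi, Real.cos_neg]
      exact hk2

theorem exists_uniform_cos_margin {θ δ : ℝ} (hθ : -1 < θ) (hθ1 : θ < 1) (hδ : 0 < δ)
    (hδ1 : δ ≤ 1) :
    ∃ κ : ℝ, 0 < κ ∧ κ ≤ 1 ∧ ∀ q : ℝ, Real.cos q ≤ 1 - δ →
      ∃ k, Real.cos k ≤ θ - κ ∧ θ + κ ≤ Real.cos (k - q) := by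
  have hτ0 : 0 < Real.arccos θ := Real.arccos_pos.2 hθ1
  have hτπ : Real.arccos θ < Real.pi := by
    rw [Real.arccos, sub_lt_iff_lt_add]
    have := Real.neg_pi_div_two_lt_arcsin.2 hθ
    linarith
  have hσ : 0 < Real.arccos (1 - δ) := Real.arccos_pos.2 (by linarith)
  set u := min (min (Real.arccos θ) (Real.pi - Real.arccos θ)) (Real.arccos (1 - δ) / 2)
  have hu : 0 < u := lt_min (lt_min hτ0 (by linarith)) (by linarith)
  have u1 : u ≤ Real.arccos θ := (min_le_left _ _).trans (min_le_left _ _)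
  have u2 : u ≤ Real.pi - Real.arccos θ := (min_le_left _ _).trans (min_le_right _ _)
  have u3 : u ≤ Real.arccos (1 - δ) / 2 := min_le_right _ _
  obtain ⟨κ, -, hκ1, hκ, h⟩ := exists_cos_margin hθ hθ1 hu.le u1 (by linarith)
  refine ⟨κ, hκ hu, hκ1, fun q hq => h q (hq.trans ?_)⟩
  calc 1 - δ = Real.cos (Real.arccos (1 - δ)) :=
        (Real.cos_arccos (by linarith) (by linarith)).symm
    _ ≤ Real.cos (2 * u) :=
        Real.cos_le_cos_of_nonneg_of_le_pi (by linarith) (Real.arccos_le_pi _) (by linarith)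

theorem exists_cos_le_and_le_cos_sub {θ : ℝ} (hθ : -1 < θ) (hθ1 : θ < 1) (q : ℝ) :
    ∃ k, Real.cos k ≤ θ ∧ θ ≤ Real.cos (k - q) := by
  obtain ⟨κ, hκ, -, -, h⟩ := exists_cos_margin hθ hθ1 le_rfl (Real.arccos_nonneg θ)
    (by rw [add_zero]; exact Real.arccos_le_pi θ)
  obtain ⟨k, h1, h2⟩ := h q (by rw [mul_zero, Real.cos_zero]; exact Real.cos_le_one q)
  exact ⟨k, by linarith, by linarith⟩

theorem stdAddChar_intCast_re {L : ℕ} [NeZero L] (n : ℤ) :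
    (ZMod.stdAddChar (n : ZMod L)).re = Real.cos (2 * Real.pi * n / L) := by
  rw [ZMod.stdAddChar_coe,
    show 2 * (Real.pi : ℂ) * Complex.I * n / L = ((2 * Real.pi * n / L : ℝ) : ℂ) * Complex.I by
      push_cast; ring, Complex.exp_ofReal_mul_I_re]

/-- The eigenvalues `∑ 2(1 - cos k_ν) - μ` of `-Δ - μ`. -/
def band {d L : ℕ} [NeZero L] (μ : ℝ) (k : Lam d L) : ℝ :=
  2 * d - μ - 2 * ∑ ν, (ZMod.stdAddChar (k ν)).re

/-- The overlap of the empty states with the shifted Fermi sea occupies a positive fraction of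
momentum space, uniformly in shifts bounded away from zero. -/
theorem exists_le_sum_band_overlap {d : ℕ} (hd : 1 ≤ d) {μ δ : ℝ} (hμ0 : 0 < μ)
    (hμ4 : μ < 4 * d) (hδ : 0 < δ) (hδ1 : δ ≤ 1) :
    ∃ (c : ℝ) (L₀ : ℕ), 0 < c ∧ ∀ (L : ℕ) [NeZero L], L₀ ≤ L → ∀ q : Lam d L,
      (∃ ν, (ZMod.stdAddChar (q ν)).re ≤ 1 - δ) →
        c * (L : ℝ) ^ d ≤ ∑ k, max (band μ k) 0 * max (-band μ (k - q)) 0 := by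
  have hd0 : (0 : ℝ) < d := by exact_mod_cast hd
  set θ : ℝ := (2 * d - μ) / (2 * d) with hθdef
  have hθ : -1 < θ := by rw [hθdef, lt_div_iff₀ (by positivity)]; linarith
  have hθ1 : θ < 1 := by rw [hθdef, div_lt_iff₀ (by positivity)]; linarith
  have hdθ : 2 * d - μ = 2 * (d * θ) := by rw [hθdef]; field_simp
  obtain ⟨κ, hκ0, hκ1, hκ⟩ := exists_uniform_cos_margin hθ hθ1 hδ hδ1
  have hπ := Real.pi_gt_three
  refine ⟨κ ^ 2 * (κ / (8 * Real.pi * d)) ^ d, ⌈8 * Real.pi * d / κ⌉₊, by positivity, ?_⟩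
  intro L _ hL q ⟨ν₀, hν₀⟩
  have hL0 : (0 : ℝ) < L := by exact_mod_cast Nat.pos_of_ne_zero (NeZero.ne L)
  have hLκ : 8 * Real.pi * d ≤ κ * L := by
    have := Nat.ceil_le.1 hL
    rw [div_le_iff₀ hκ0] at this
    linarith
  set J : ℕ := ⌊κ * L / (4 * Real.pi * d)⌋₊ with hJ
  have hJle : (J : ℝ) ≤ κ * L / (4 * Real.pi * d) := Nat.floor_le (by positivity)
  have hJge : κ / (8 * Real.pi * d) * L ≤ J := by
    have h1 : κ * L / (4 * Real.pi * d) - 1 < J := Nat.sub_one_lt_floor _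
    have h2 : 2 ≤ κ * L / (4 * Real.pi * d) := by
      rw [le_div_iff₀ (by positivity)]; linarith
    have h3 : κ / (8 * Real.pi * d) * L = κ * L / (4 * Real.pi * d) / 2 := by
      field_simp; norm_num
    linarith
  have hJL : J ≤ L := by
    have : (J : ℝ) ≤ L := by
      refine hJle.trans ?_
      rw [div_le_iff₀ (by positivity)]
      have hd1 : (1 : ℝ) ≤ d := by exact_mod_cast hd
      nlinarith [mul_le_mul hπ.le hd1 zero_le_one Real.pi_pos.le]
    exact_mod_cast this
  have hstep : 2 * Real.pi * J / L ≤ κ / (2 * d) := by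
    rw [div_le_iff₀ hL0]
    calc 2 * Real.pi * J ≤ 2 * Real.pi * (κ * L / (4 * Real.pi * d)) := by gcongr
      _ = κ / (2 * d) * L := by field_simp; norm_num
  set a : Fin d → ℝ := fun ν => 2 * Real.pi * ((q ν).val : ℤ) / L with ha
  have hqa : ∀ ν, (ZMod.stdAddChar (q ν)).re = Real.cos (a ν) := by
    intro ν
    rw [ha, ← stdAddChar_intCast_re]
    simp
  have hsel : ∀ ν, ∃ x, Real.cos x ≤ θ - (if ν = ν₀ then κ else 0) ∧
      θ + (if ν = ν₀ then κ else 0) ≤ Real.cos (x - a ν) := by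
    intro ν
    split_ifs with h
    · exact hκ _ (by rw [← hqa, h]; exact hν₀)
    · simpa using exists_cos_le_and_le_cos_sub hθ hθ1 (a ν)
  choose x hx1 hx2 using hsel
  set n₀ : Fin d → ℤ := fun ν => ⌈x ν * L / (2 * Real.pi)⌉ with hn₀
  set ι : (Fin d → Fin J) → Lam d L := fun j ν => ((n₀ ν + ((j ν : ℕ) : ℤ) : ℤ) : ZMod L) with hι
  have hinj : Function.Injective ι := by
    intro i j hij
    funext ν
    have h := congrFun hij ν
    simp only [hι, Int.cast_add, add_right_inj, Int.cast_natCast] at h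
    rw [ZMod.natCast_eq_natCast_iff', Nat.mod_eq_of_lt ((i ν).2.trans_le hJL),
      Nat.mod_eq_of_lt ((j ν).2.trans_le hJL)] at h
    exact Fin.ext h
  have hdist : ∀ j : Fin d → Fin J, ∀ ν,
      |2 * Real.pi * (n₀ ν + ((j ν : ℕ) : ℤ) : ℤ) / L - x ν| ≤ κ / (2 * d) := by
    intro j ν
    have h1 : x ν * L / (2 * Real.pi) ≤ n₀ ν := Int.le_ceil _
    have h2 : (n₀ ν : ℝ) < x ν * L / (2 * Real.pi) + 1 := Int.ceil_lt_add_one _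
    have h3 : ((j ν : ℕ) : ℝ) + 1 ≤ J := by exact_mod_cast (j ν).2
    have h4 : (0 : ℝ) ≤ ((j ν : ℕ) : ℝ) := Nat.cast_nonneg _
    rw [div_le_iff₀ (by positivity)] at h1
    have h2' : (n₀ ν : ℝ) - 1 < x ν * L / (2 * Real.pi) := by linarith
    rw [lt_div_iff₀ (by positivity)] at h2'
    push_cast
    rw [abs_of_nonneg, sub_le_iff_le_add]
    · refine le_trans ?_ (add_le_add_left hstep (x ν))
      rw [div_add' _ _ _ hL0.ne', div_le_div_iff_of_pos_right hL0]
      nlinarith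
    · rw [sub_nonneg, le_div_iff₀ hL0]
      nlinarith
  have hδsum : ∑ ν : Fin d, (if ν = ν₀ then κ else 0) = κ := by simp
  have hconst : ∑ _ν : Fin d, (θ + κ / (2 * d)) = d * θ + κ / 2 := by
    rw [Finset.sum_const, Finset.card_univ, Fintype.card_fin, nsmul_eq_mul]
    field_simp
  have hconst' : ∑ _ν : Fin d, (θ - κ / (2 * d)) = d * θ - κ / 2 := by
    rw [Finset.sum_const, Finset.card_univ, Fintype.card_fin, nsmul_eq_mul]
    field_simp
  have hE1 : ∀ j, κ ≤ band μ (ι j) := by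
    intro j
    have : ∑ ν, (ZMod.stdAddChar (ι j ν)).re ≤
        ∑ ν, ((θ + κ / (2 * d)) - (if ν = ν₀ then κ else 0)) := by
      refine Finset.sum_le_sum fun ν _ => ?_
      rw [hι, stdAddChar_intCast_re]
      have h1 := (abs_le.1 ((Real.abs_cos_sub_cos_le _ _).trans (hdist j ν))).2
      have h2 := hx1 ν
      linarith
    rw [Finset.sum_sub_distrib, hδsum, hconst] at this
    rw [band, hdθ]
    linarith
  have hE2 : ∀ j, κ ≤ -band μ (ι j - q) := by
    intro j
    have : ∑ ν, ((θ - κ / (2 * d)) + (if ν = ν₀ then κ else 0)) ≤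
        ∑ ν, (ZMod.stdAddChar ((ι j - q) ν)).re := by
      refine Finset.sum_le_sum fun ν _ => ?_
      have h0 : (ι j - q) ν =
          (((n₀ ν + ((j ν : ℕ) : ℤ)) - ((q ν).val : ℤ) : ℤ) : ZMod L) := by
        rw [Pi.sub_apply, hι]
        push_cast
        rw [ZMod.natCast_zmod_val]
      rw [h0, stdAddChar_intCast_re]
      have h3 : 2 * Real.pi * (((n₀ ν + ((j ν : ℕ) : ℤ)) - ((q ν).val : ℤ) : ℤ) : ℝ) / L
          - (x ν - a ν) = 2 * Real.pi * (n₀ ν + ((j ν : ℕ) : ℤ) : ℤ) / L - x ν := by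
        rw [ha]
        push_cast
        ring
      have h1 := (abs_le.1 ((Real.abs_cos_sub_cos_le _ _).trans ((congrArg abs h3).trans_le
        (hdist j ν)))).1
      have h2 := hx2 ν
      linarith
    rw [Finset.sum_add_distrib, hδsum, hconst'] at this
    rw [band, hdθ]
    linarith
  have hterm : ∀ k : Lam d L, 0 ≤ max (band μ k) 0 * max (-band μ (k - q)) 0 :=
    fun k => mul_nonneg (le_max_right _ _) (le_max_right _ _)
  calc κ ^ 2 * (κ / (8 * Real.pi * d)) ^ d * (L : ℝ) ^ d
      = κ ^ 2 * (κ / (8 * Real.pi * d) * L) ^ d := by rw [mul_pow]; ring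
    _ ≤ κ ^ 2 * (J : ℝ) ^ d := by gcongr
    _ = ∑ _j : Fin d → Fin J, κ ^ 2 := by
        rw [Finset.sum_const, Finset.card_univ, Fintype.card_fun, Fintype.card_fin,
          Fintype.card_fin, nsmul_eq_mul, Nat.cast_pow]
        ring
    _ ≤ ∑ j, max (band μ (ι j)) 0 * max (-band μ (ι j - q)) 0 := by
        refine Finset.sum_le_sum fun j _ => ?_
        rw [sq]
        exact mul_le_mul ((hE1 j).trans (le_max_left _ _)) ((hE2 j).trans (le_max_left _ _))
          hκ0.le (le_max_right _ _)
    _ = ∑ k ∈ Finset.univ.image ι, max (band μ k) 0 * max (-band μ (k - q)) 0 := by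
        rw [Finset.sum_image fun _ _ _ _ h => hinj h]
    _ ≤ _ := Finset.sum_le_univ_sum_of_nonneg hterm

/-- The plane wave with momentum `k` on the torus. -/
def planeWave {d L : ℕ} [NeZero L] (k x : Lam d L) : ℂ := ZMod.stdAddChar (k ⬝ᵥ x)

section PlaneWave

variable {d L : ℕ} [NeZero L]

theorem planeWave_add_right (k x y : Lam d L) :
    planeWave k (x + y) = planeWave k x * planeWave k y := by
  simp only [planeWave, dotProduct_add, AddChar.map_add_eq_mul]

theorem star_planeWave (k x : Lam d L) : star (planeWave k x) = planeWave k (-x) := by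
  simp only [planeWave, dotProduct_neg, AddChar.map_neg_eq_conj, RCLike.star_def]

theorem star_planeWave_mul (k l x : Lam d L) :
    star (planeWave k x) * planeWave l x = planeWave (l - k) x := by
  rw [star_planeWave]
  simp only [planeWave, ← AddChar.map_add_eq_mul, dotProduct_neg, sub_dotProduct]
  congr 1
  ring

theorem planeWave_single (k : Lam d L) (ν : Fin d) :
    planeWave k (Pi.single ν 1) = ZMod.stdAddChar (k ν) := by
  simp [planeWave]

theorem norm_planeWave (k x : Lam d L) : ‖planeWave k x‖ = 1 := by
  simp [planeWave]

theorem sum_planeWave (k : Lam d L) :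
    ∑ x, planeWave k x = if k = 0 then (L : ℂ) ^ d else 0 := by
  split_ifs with h
  · simp [planeWave, h, ZMod.card]
  · obtain ⟨ν, hν⟩ : ∃ ν, k ν ≠ 0 := by
      by_contra! h'
      exact h (funext h')
    have h1 : (ZMod.stdAddChar (k ν) : ℂ) ≠ 1 := fun h' =>
      hν (ZMod.injective_stdAddChar (h'.trans (AddChar.map_zero_eq_one _).symm))
    have h2 : ZMod.stdAddChar (k ν) * ∑ x, planeWave k x = ∑ x, planeWave k x := by
      rw [← planeWave_single, Finset.mul_sum]
      simp only [← planeWave_add_right]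
      exact Fintype.sum_equiv (Equiv.addLeft (Pi.single ν 1)) _ _ fun x => rfl
    have h3 : (ZMod.stdAddChar (k ν) - 1) * ∑ x, planeWave k x = 0 := by
      rw [sub_mul, one_mul, h2, sub_self]
    exact (mul_eq_zero.1 h3).resolve_left (sub_ne_zero.2 h1)

variable (d L) in
/-- The unitary matrix whose columns are the normalized plane waves. -/
def fourierMatrix : Matrix (Lam d L) (Lam d L) ℂ :=
  Matrix.of fun x k => ((Real.sqrt ((L : ℝ) ^ d))⁻¹ : ℝ) * planeWave k x

omit [NeZero L] in
theorem inv_sqrt_card_mul_self :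
    ((Real.sqrt ((L : ℝ) ^ d))⁻¹ : ℝ) * (Real.sqrt ((L : ℝ) ^ d))⁻¹ = ((L : ℝ) ^ d)⁻¹ := by
  rw [← mul_inv, Real.mul_self_sqrt (by positivity)]

theorem fourierMatrix_conjTranspose_mul_self :
    (fourierMatrix d L)ᴴ * fourierMatrix d L = 1 := by
  ext k l
  have hL : (L : ℂ) ^ d ≠ 0 := pow_ne_zero _ (Nat.cast_ne_zero.2 (NeZero.ne L))
  have h : ∀ x, (fourierMatrix d L)ᴴ k x * fourierMatrix d L x l =
      ((L : ℂ) ^ d)⁻¹ * planeWave (l - k) x := by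
    intro x
    rw [← star_planeWave_mul]
    simp only [fourierMatrix, Matrix.conjTranspose_apply, Matrix.of_apply, star_mul',
      RCLike.star_def, Complex.conj_ofReal]
    have := congrArg (Complex.ofReal) (inv_sqrt_card_mul_self (d := d) (L := L))
    push_cast at this ⊢
    rw [← this]
    ring
  rw [Matrix.mul_apply, Finset.sum_congr rfl fun x _ => h x, ← Finset.mul_sum, sum_planeWave,
    Matrix.one_apply]
  simp only [sub_eq_zero, eq_comm (a := l)]
  split_ifs
  · exact inv_mul_cancel₀ hL
  · simp

/-- The unitary discrete Fourier transform on the torus. -/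
def torusFourier (f : Lam d L → ℂ) : Lam d L → ℂ := (fourierMatrix d L)ᴴ *ᵥ f

theorem torusFourier_apply (f : Lam d L → ℂ) (q : Lam d L) : torusFourier f q =
    ((Real.sqrt ((L : ℝ) ^ d))⁻¹ : ℝ) * ∑ x, star (planeWave q x) * f x := by
  simp only [torusFourier, Matrix.mulVec, dotProduct, Matrix.conjTranspose_apply, fourierMatrix,
    Matrix.of_apply, star_mul', RCLike.star_def, Complex.conj_ofReal, Finset.mul_sum, mul_assoc]

theorem sum_norm_sq_torusFourier (f : Lam d L → ℂ) :
    ∑ q, ‖torusFourier f q‖ ^ 2 = ∑ x, ‖f x‖ ^ 2 := by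
  have h : ∀ g : Lam d L → ℂ, ((∑ q, ‖g q‖ ^ 2 : ℝ) : ℂ) = star g ⬝ᵥ g := by
    intro g
    push_cast
    refine Finset.sum_congr rfl fun q _ => ?_
    rw [Pi.star_apply, RCLike.star_def, Complex.conj_mul']
  have hU : fourierMatrix d L * (fourierMatrix d L)ᴴ = 1 :=
    mul_eq_one_comm.1 fourierMatrix_conjTranspose_mul_self
  have : ((∑ q, ‖torusFourier f q‖ ^ 2 : ℝ) : ℂ) = ((∑ x, ‖f x‖ ^ 2 : ℝ) : ℂ) := by
    rw [h, h, torusFourier, Matrix.star_mulVec, Matrix.conjTranspose_conjTranspose,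
      ← Matrix.dotProduct_mulVec, Matrix.mulVec_mulVec, hU, Matrix.one_mulVec]
  exact_mod_cast this

theorem torusFourier_translate (f : Lam d L → ℂ) (y q : Lam d L) :
    torusFourier (fun x => f (x + y)) q = planeWave q y * torusFourier f q := by
  rw [torusFourier_apply, torusFourier_apply, mul_left_comm]
  congr 1
  rw [Finset.mul_sum]
  refine Fintype.sum_equiv (Equiv.addRight y) _ _ fun x => ?_
  have h : planeWave q y * star (planeWave q y) = 1 := by
    rw [RCLike.star_def, Complex.mul_conj', norm_planeWave]; simp
  rw [Equiv.coe_addRight, planeWave_add_right, star_mul', ← mul_assoc, mul_left_comm, h, mul_one]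

theorem norm_sq_proj_fourier (Ω : Set (Lam d L)) (k l : Lam d L) :
    ‖((fourierMatrix d L)ᴴ * proj Ω * fourierMatrix d L) k l‖ ^ 2 =
      ((L : ℝ) ^ d)⁻¹ * ‖torusFourier (fun x => if x ∈ Ω then 1 else 0) (k - l)‖ ^ 2 := by
  have h : ((fourierMatrix d L)ᴴ * proj Ω * fourierMatrix d L) k l =
      ((Real.sqrt ((L : ℝ) ^ d))⁻¹ : ℝ) *
        torusFourier (fun x => if x ∈ Ω then 1 else 0) (k - l) := by
    rw [torusFourier_apply, Matrix.mul_apply, Finset.mul_sum, Finset.mul_sum]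
    refine Finset.sum_congr rfl fun x _ => ?_
    have e : star (planeWave (k - l) x) = star (planeWave k x) * planeWave l x := by
      rw [star_planeWave_mul, star_planeWave]
      simp only [planeWave, dotProduct_neg, sub_dotProduct, neg_sub]
    rw [e, proj, Matrix.mul_diagonal]
    simp only [Matrix.conjTranspose_apply, fourierMatrix, Matrix.of_apply, star_mul',
      RCLike.star_def, Complex.conj_ofReal]
    ring
  rw [h, norm_mul, mul_pow, Complex.norm_real, Real.norm_eq_abs, sq_abs, sq,
    inv_sqrt_card_mul_self]

end PlaneWave

section Lattice

variable {d L : ℕ}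

theorem isNN_iff (x y : Lam d L) :
    isNN x y ↔ ∃ ν, y = x + Pi.single ν 1 ∨ y = x - Pi.single ν 1 := by
  refine exists_congr fun ν => ⟨?_, ?_⟩
  · rintro ⟨h | h, h'⟩
    · right
      funext μ
      by_cases e : μ = ν
      · subst e; simp [h]
      · simp [e, h' μ e]
    · left
      funext μ
      by_cases e : μ = ν
      · subst e; simp [h]
      · simp [e, h' μ e]
  · rintro (h | h)
    · subst h
      exact ⟨Or.inr (by simp), fun μ hμ => by simp [hμ]⟩
    · subst h
      exact ⟨Or.inl (by simp), fun μ hμ => by simp [hμ]⟩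

theorem ite_isNN_eq_sum (hL : 3 ≤ L) (x y : Lam d L) :
    (if isNN x y then (1 : ℂ) else 0) =
      ∑ ν, ((if y = x + Pi.single ν 1 then 1 else 0) +
        (if y = x - Pi.single ν 1 then 1 else 0)) := by
  have h1 : (1 : ZMod L) ≠ 0 := by
    intro h
    have := (ZMod.natCast_eq_zero_iff 1 L).1 (by exact_mod_cast h)
    have := Nat.le_of_dvd one_pos this
    omega
  have h2 : (1 : ZMod L) + 1 ≠ 0 := by
    intro h
    have := (ZMod.natCast_eq_zero_iff 2 L).1 (by push_cast; rw [← h]; norm_num)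
    have := Nat.le_of_dvd two_pos this
    omega
  have hinj : ∀ ν ν' : Fin d, (Pi.single ν 1 : Lam d L) = Pi.single ν' 1 ↔ ν' = ν := by
    intro ν ν'
    refine ⟨fun h => ?_, fun h => by rw [h]⟩
    by_contra hne
    have := congrFun h ν
    rw [Pi.single_eq_same, Pi.single_eq_of_ne (Ne.symm hne)] at this
    exact h1 this
  have hneg : ∀ ν ν' : Fin d, (Pi.single ν 1 : Lam d L) + Pi.single ν' 1 ≠ 0 := by
    intro ν ν' h
    have := congrFun h ν
    rw [Pi.add_apply, Pi.single_eq_same, Pi.zero_apply] at this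
    by_cases e : ν = ν'
    · subst e
      rw [Pi.single_eq_same] at this
      exact h2 this
    · rw [Pi.single_eq_of_ne e, add_zero] at this
      exact h1 this
  by_cases h : isNN x y
  · rw [if_pos h]
    obtain ⟨ν, rfl | rfl⟩ := (isNN_iff x y).1 h
    · have e : ∀ ν' : Fin d, ¬ x + (Pi.single ν 1 : Lam d L) = x - Pi.single ν' 1 := fun ν' h' =>
        hneg ν ν' (by
          rw [sub_eq_add_neg, add_right_inj] at h'
          rw [h', neg_add_cancel])
      simp [e, hinj]
    · have e : ∀ ν' : Fin d, ¬ x - (Pi.single ν 1 : Lam d L) = x + Pi.single ν' 1 := fun ν' h' =>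
        hneg ν ν' (by
          rw [sub_eq_add_neg, add_right_inj] at h'
          rw [← h', add_neg_cancel])
      simp [e, hinj]
  · rw [if_neg h]
    rw [isNN_iff] at h
    push Not at h
    simp [h]

variable [NeZero L]

theorem lap_mulVec_apply (hL : 3 ≤ L) (f : Lam d L → ℂ) (x : Lam d L) :
    (lap d L *ᵥ f) x =
      ∑ ν, (f (x + Pi.single ν 1) + f (x - Pi.single ν 1)) - 2 * d * f x := by
  rw [lap, Matrix.sub_mulVec, Pi.sub_apply, Matrix.smul_mulVec, Matrix.one_mulVec,
    Pi.smul_apply, smul_eq_mul]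
  congr 1
  simp only [Matrix.mulVec, dotProduct, Matrix.of_apply, ite_isNN_eq_sum hL, Finset.sum_mul]
  rw [Finset.sum_comm]
  refine Finset.sum_congr rfl fun ν _ => ?_
  simp [add_mul, Finset.sum_add_distrib]

theorem neg_lap_sub_mulVec_planeWave (hL : 3 ≤ L) (μ : ℝ) (k : Lam d L) :
    (-(lap d L) - (μ : ℂ) • 1) *ᵥ planeWave k = (band μ k : ℂ) • planeWave k := by
  funext x
  rw [Matrix.sub_mulVec, Matrix.neg_mulVec, Matrix.smul_mulVec, Matrix.one_mulVec, Pi.sub_apply,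
    Pi.neg_apply, lap_mulVec_apply hL]
  have h : ∀ ν : Fin d, planeWave k (x + Pi.single ν 1) + planeWave k (x - Pi.single ν 1) =
      2 * ((ZMod.stdAddChar (k ν)).re : ℂ) * planeWave k x := by
    intro ν
    rw [sub_eq_add_neg, planeWave_add_right, planeWave_add_right, ← star_planeWave,
      planeWave_single, ← mul_add, RCLike.star_def, Complex.add_conj]
    push_cast
    ring
  simp only [h, Pi.smul_apply, smul_eq_mul, band]
  rw [← Finset.sum_mul, ← Finset.mul_sum]
  push_cast
  ring

theorem neg_lap_sub_eq_fourier (hL : 3 ≤ L) (μ : ℝ) :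
    -(lap d L) - (μ : ℂ) • 1 = fourierMatrix d L *
      Matrix.diagonal (fun k => (band μ k : ℂ)) * (fourierMatrix d L)ᴴ := by
  have hU : fourierMatrix d L * (fourierMatrix d L)ᴴ = 1 :=
    mul_eq_one_comm.1 fourierMatrix_conjTranspose_mul_self
  have h : (-(lap d L) - (μ : ℂ) • 1) * fourierMatrix d L =
      fourierMatrix d L * Matrix.diagonal (fun k => (band μ k : ℂ)) := by
    ext x k
    have hcol : (fun y => fourierMatrix d L y k) =
        (((Real.sqrt ((L : ℝ) ^ d))⁻¹ : ℝ) : ℂ) • planeWave k := rfl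
    have hx : ((-(lap d L) - (μ : ℂ) • 1) * fourierMatrix d L) x k =
        ((-(lap d L) - (μ : ℂ) • 1) *ᵥ (fun y => fourierMatrix d L y k)) x := rfl
    rw [Matrix.mul_diagonal, hx, hcol, Matrix.mulVec_smul, neg_lap_sub_mulVec_planeWave hL]
    simp only [Pi.smul_apply, smul_eq_mul, fourierMatrix, Matrix.of_apply]
    ring
  rw [← h, mul_assoc, hU, mul_one]

end Lattice

section Boundary

variable {d L : ℕ} [NeZero L]

theorem norm_one_sub_stdAddChar_sq (a : ZMod L) :
    ‖1 - (ZMod.stdAddChar a : ℂ)‖ ^ 2 = 2 - 2 * (ZMod.stdAddChar a : ℂ).re := by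
  have h : ‖(ZMod.stdAddChar a : ℂ)‖ ^ 2 = 1 := by simp
  rw [Complex.sq_norm, Complex.normSq_apply] at h ⊢
  simp only [Complex.sub_re, Complex.one_re, Complex.sub_im, Complex.one_im]
  linarith

theorem abs_re_stdAddChar_le_one (a : ZMod L) : |(ZMod.stdAddChar a : ℂ).re| ≤ 1 :=
  (Complex.abs_re_le_norm _).trans (by simp)

theorem band_zero_eq_sum (q : Lam d L) :
    band 0 q = ∑ ν, ‖1 - (ZMod.stdAddChar (q ν) : ℂ)‖ ^ 2 := by
  simp only [norm_one_sub_stdAddChar_sq, Finset.sum_sub_distrib, ← Finset.mul_sum, band]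
  simp
  ring

theorem band_eq_band_zero_sub (μ : ℝ) (q : Lam d L) : band μ q = band 0 q - μ := by
  simp only [band]
  ring

theorem band_zero_nonneg (q : Lam d L) : 0 ≤ band 0 q := by
  rw [band_zero_eq_sum]
  positivity

theorem band_zero_le (q : Lam d L) : band 0 q ≤ 4 * d := by
  have h : -(d : ℝ) ≤ ∑ ν, (ZMod.stdAddChar (q ν) : ℂ).re := by
    have := Finset.sum_le_sum fun ν (_ : ν ∈ Finset.univ) =>
      (abs_le.1 (abs_re_stdAddChar_le_one (q ν))).1
    simpa using this
  simp only [band]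
  linarith

theorem sq_band_sub_band_le (μ : ℝ) (k l : Lam d L) :
    (band μ k - band μ l) ^ 2 ≤ 4 * d * band 0 (k - l) := by
  have h : band μ k - band μ l =
      2 * ∑ ν, ((ZMod.stdAddChar (l ν) : ℂ).re - (ZMod.stdAddChar (k ν) : ℂ).re) := by
    simp only [band, Finset.sum_sub_distrib]
    ring
  have h1 : ∀ ν, ((ZMod.stdAddChar (l ν) : ℂ).re - (ZMod.stdAddChar (k ν) : ℂ).re) ^ 2 ≤
      ‖1 - (ZMod.stdAddChar ((k - l) ν) : ℂ)‖ ^ 2 := by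
    intro ν
    have e : (ZMod.stdAddChar (l ν) : ℂ) - ZMod.stdAddChar (k ν) =
        ZMod.stdAddChar (l ν) * (1 - ZMod.stdAddChar ((k - l) ν)) := by
      rw [mul_sub, mul_one, ← AddChar.map_add_eq_mul, Pi.sub_apply, add_sub_cancel]
    have e' := congrArg norm e
    rw [norm_mul, AddChar.norm_apply, one_mul] at e'
    rw [← Complex.sub_re, ← sq_abs, ← e']
    exact pow_le_pow_left₀ (abs_nonneg _) (Complex.abs_re_le_norm _) 2
  have h2 := sq_sum_le_card_mul_sum_sq (s := Finset.univ)
    (f := fun ν => (ZMod.stdAddChar (l ν) : ℂ).re - (ZMod.stdAddChar (k ν) : ℂ).re)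
  rw [Finset.card_univ, Fintype.card_fin] at h2
  have h3 := Finset.sum_le_sum fun ν (_ : ν ∈ Finset.univ) => h1 ν
  rw [h, mul_pow, band_zero_eq_sum]
  have := mul_le_mul_of_nonneg_left h3 (Nat.cast_nonneg (α := ℝ) d)
  linarith

theorem abs_band_le {μ : ℝ} (hμ0 : 0 ≤ μ) (hμ4 : μ ≤ 4 * d) (q : Lam d L) :
    |band μ q| ≤ 4 * d := by
  rw [band_eq_band_zero_sub, abs_le]
  have := band_zero_nonneg q
  have := band_zero_le q
  constructor <;> linarith

/-- The power spectrum of the indicator function of a subset of the torus. -/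
def indicatorSpectrum (Ω : Set (Lam d L)) (q : Lam d L) : ℝ :=
  ‖torusFourier (fun x => if x ∈ Ω then 1 else 0) q‖ ^ 2

theorem indicatorSpectrum_nonneg (Ω : Set (Lam d L)) (q : Lam d L) :
    0 ≤ indicatorSpectrum Ω q := sq_nonneg _

theorem sum_indicator_bdry (Ω : Set (Lam d L)) :
    ∑ x, (if x ∈ bdry Ω then (1 : ℝ) else 0) = (bdry Ω).ncard := by
  rw [Finset.sum_boole, Set.ncard_eq_toFinset_card']
  congr 2
  ext x
  simp

omit [NeZero L] in
theorem norm_indicator_sub_le (Ω : Set (Lam d L)) (ν : Fin d) (x : Lam d L) :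
    ‖(if x ∈ Ω then (1 : ℂ) else 0) - (if x + Pi.single ν 1 ∈ Ω then 1 else 0)‖ ^ 2 ≤
      (if x ∈ bdry Ω then (1 : ℝ) else 0) +
        (if x + Pi.single ν 1 ∈ bdry Ω then (1 : ℝ) else 0) := by
  have h0 : ∀ y, (0 : ℝ) ≤ if y ∈ bdry Ω then (1 : ℝ) else 0 := fun y => by
    split_ifs <;> norm_num
  have ha := h0 x
  have hb := h0 (x + Pi.single ν 1)
  by_cases h1 : x ∈ Ω <;> by_cases h2 : x + Pi.single ν 1 ∈ Ω
  · simp only [h1, h2, if_true, sub_self, norm_zero]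
    linarith
  · have : x ∈ bdry Ω := ⟨h1, _, h2, (isNN_iff _ _).2 ⟨ν, Or.inl rfl⟩⟩
    simp only [h1, h2, this, if_true, if_false, sub_zero, norm_one]
    linarith
  · have : x + Pi.single ν 1 ∈ bdry Ω :=
      ⟨h2, x, h1, (isNN_iff _ _).2 ⟨ν, Or.inr (add_sub_cancel_right _ _).symm⟩⟩
    simp only [h1, h2, this, if_true, if_false, zero_sub, norm_neg, norm_one]
    linarith
  · simp only [h1, h2, if_false, sub_self, norm_zero]
    linarith

theorem sum_indicatorSpectrum_mul_band_le (Ω : Set (Lam d L)) :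
    ∑ q, indicatorSpectrum Ω q * band 0 q ≤ 2 * d * (bdry Ω).ncard := by
  set p : Lam d L → ℂ := fun x => if x ∈ Ω then 1 else 0 with hp
  have h1 : ∀ ν : Fin d, ∑ q, indicatorSpectrum Ω q * ‖1 - (ZMod.stdAddChar (q ν) : ℂ)‖ ^ 2 =
      ∑ x, ‖p x - p (x + Pi.single ν 1)‖ ^ 2 := by
    intro ν
    rw [← sum_norm_sq_torusFourier]
    refine Finset.sum_congr rfl fun q _ => ?_
    have e : torusFourier (fun x => p x - p (x + Pi.single ν 1)) q =
        (1 - ZMod.stdAddChar (q ν)) * torusFourier p q := by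
      rw [sub_mul, one_mul, ← planeWave_single, ← torusFourier_translate]
      simp only [torusFourier]
      rw [← Pi.sub_apply, ← Matrix.mulVec_sub]
      rfl
    rw [e, norm_mul, mul_pow, mul_comm]
    rfl
  have h2 : ∀ ν : Fin d, ∑ x, ‖p x - p (x + Pi.single ν 1)‖ ^ 2 ≤ 2 * (bdry Ω).ncard := by
    intro ν
    refine (Finset.sum_le_sum fun x _ => norm_indicator_sub_le Ω ν x).trans_eq ?_
    have e : ∑ x : Lam d L, (if x + Pi.single ν 1 ∈ bdry Ω then (1 : ℝ) else 0) =
        (bdry Ω).ncard := by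
      rw [← sum_indicator_bdry Ω]
      exact Equiv.sum_comp (Equiv.addRight (Pi.single ν 1 : Lam d L))
        fun x => if x ∈ bdry Ω then (1 : ℝ) else 0
    rw [Finset.sum_add_distrib, sum_indicator_bdry, e]
    ring
  calc ∑ q, indicatorSpectrum Ω q * band 0 q
      = ∑ ν : Fin d, ∑ q, indicatorSpectrum Ω q * ‖1 - (ZMod.stdAddChar (q ν) : ℂ)‖ ^ 2 := by
        rw [Finset.sum_comm]
        simp only [← Finset.mul_sum, band_zero_eq_sum]
    _ ≤ ∑ _ν : Fin d, 2 * ((bdry Ω).ncard : ℝ) :=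
        Finset.sum_le_sum fun ν _ => (h1 ν).trans_le (h2 ν)
    _ = 2 * d * (bdry Ω).ncard := by simp; ring

theorem one_le_norm_lap_indicator (hL : 3 ≤ L) {Ω : Set (Lam d L)} {x : Lam d L}
    (hx : x ∈ bdry Ω) : 1 ≤ ‖(lap d L *ᵥ fun x => if x ∈ Ω then 1 else 0) x‖ := by
  obtain ⟨hxΩ, y, hy, hxy⟩ := hx
  set r : Lam d L → ℝ := fun x => if x ∈ Ω then 1 else 0 with hr
  have hr1 : ∀ z, r z ≤ 1 := fun z => by simp only [hr]; split_ifs <;> norm_num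
  have e : (lap d L *ᵥ fun x => if x ∈ Ω then 1 else 0) x =
      ((∑ ν, (r (x + Pi.single ν 1) + r (x - Pi.single ν 1) - 2) : ℝ) : ℂ) := by
    rw [lap_mulVec_apply hL, if_pos hxΩ, Finset.sum_sub_distrib]
    push_cast
    simp only [hr, apply_ite Complex.ofReal, Complex.ofReal_one, Complex.ofReal_zero]
    simp
    ring
  have hle : ∑ ν, (r (x + Pi.single ν 1) + r (x - Pi.single ν 1) - 2) ≤ -1 := by
    obtain ⟨ν, hν⟩ := (isNN_iff x y).1 hxy
    have hs : ∀ ν', r (x + Pi.single ν' 1) + r (x - Pi.single ν' 1) - 2 ≤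
        if ν' = ν then -1 else 0 := by
      intro ν'
      have a := hr1 (x + Pi.single ν' 1)
      have b := hr1 (x - Pi.single ν' 1)
      have c : r y = 0 := if_neg hy
      split_ifs with h
      · subst h
        rcases hν with rfl | rfl <;> linarith
      · linarith
    exact (Finset.sum_le_sum fun ν' _ => hs ν').trans_eq (by simp)
  rw [e, Complex.norm_real, Real.norm_eq_abs, abs_of_nonpos (by linarith)]
  linarith

theorem ncard_bdry_le_sum (hL : 3 ≤ L) (Ω : Set (Lam d L)) :
    ((bdry Ω).ncard : ℝ) ≤ ∑ q, indicatorSpectrum Ω q * band 0 q ^ 2 := by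
  set p : Lam d L → ℂ := fun x => if x ∈ Ω then 1 else 0 with hp
  have hlap : lap d L = -(fourierMatrix d L *
      Matrix.diagonal (fun k => (band 0 k : ℂ)) * (fourierMatrix d L)ᴴ) := by
    rw [← neg_lap_sub_eq_fourier hL]
    simp
  have h : ∀ q, indicatorSpectrum Ω q * band 0 q ^ 2 = ‖torusFourier (lap d L *ᵥ p) q‖ ^ 2 := by
    intro q
    have e : torusFourier (lap d L *ᵥ p) q = -((band 0 q : ℂ) * torusFourier p q) := by
      rw [torusFourier, Matrix.mulVec_mulVec, hlap, mul_neg, ← mul_assoc, ← mul_assoc,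
        fourierMatrix_conjTranspose_mul_self, one_mul, Matrix.neg_mulVec, ← Matrix.mulVec_mulVec,
        Pi.neg_apply, Matrix.mulVec_diagonal]
      rfl
    rw [e, norm_neg, norm_mul, mul_pow, Complex.norm_real, Real.norm_eq_abs, sq_abs, mul_comm]
    rfl
  rw [Finset.sum_congr rfl fun q _ => h q, sum_norm_sq_torusFourier, ← sum_indicator_bdry]
  refine Finset.sum_le_sum fun x _ => ?_
  split_ifs with hx
  · have := one_le_norm_lap_indicator hL hx
    exact one_le_pow₀ this
  · positivity

theorem sum_mul_norm_sq_proj_fourier (Ω : Set (Lam d L)) (f : Lam d L → Lam d L → ℝ) :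
    ∑ k, ∑ l, f k l * ‖((fourierMatrix d L)ᴴ * proj Ω * fourierMatrix d L) k l‖ ^ 2 =
      ((L : ℝ) ^ d)⁻¹ * ∑ q, indicatorSpectrum Ω q * ∑ k, f k (k - q) := by
  simp only [norm_sq_proj_fourier, Finset.mul_sum]
  rw [Finset.sum_comm (γ := Lam d L) (s := Finset.univ)
    (f := fun q k => ((L : ℝ) ^ d)⁻¹ * (indicatorSpectrum Ω q * f k (k - q)))]
  refine Finset.sum_congr rfl fun k _ => ?_
  refine Fintype.sum_equiv (Equiv.subLeft k) _ _ fun l => ?_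
  rw [Equiv.subLeft_apply, sub_sub_cancel, indicatorSpectrum]
  ring

theorem sum_sq_band_sub_mul_le (μ : ℝ) (Ω : Set (Lam d L)) :
    ∑ k, ∑ l, (band μ k - band μ l) ^ 2 *
        ‖((fourierMatrix d L)ᴴ * proj Ω * fourierMatrix d L) k l‖ ^ 2 ≤
      8 * d ^ 2 * (bdry Ω).ncard := by
  have hL : (0 : ℝ) < (L : ℝ) ^ d := pow_pos (Nat.cast_pos.2 (NeZero.pos L)) _
  rw [sum_mul_norm_sq_proj_fourier Ω fun k l => (band μ k - band μ l) ^ 2]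
  have h1 : ∀ q : Lam d L, ∑ k, (band μ k - band μ (k - q)) ^ 2 ≤
      (L : ℝ) ^ d * (4 * d * band 0 q) := by
    intro q
    refine (Finset.sum_le_sum fun k _ => sq_band_sub_band_le μ k (k - q)).trans_eq ?_
    simp [ZMod.card]
  calc ((L : ℝ) ^ d)⁻¹ * ∑ q, indicatorSpectrum Ω q * ∑ k, (band μ k - band μ (k - q)) ^ 2
      ≤ ((L : ℝ) ^ d)⁻¹ * ∑ q, indicatorSpectrum Ω q * ((L : ℝ) ^ d * (4 * d * band 0 q)) := by
        gcongr with q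
        · exact indicatorSpectrum_nonneg Ω q
        · exact h1 q
    _ = 4 * d * ∑ q, indicatorSpectrum Ω q * band 0 q := by
        rw [Finset.mul_sum, Finset.mul_sum]
        refine Finset.sum_congr rfl fun q _ => ?_
        field_simp
    _ ≤ 4 * d * (2 * d * (bdry Ω).ncard) := by
        gcongr
        exact sum_indicatorSpectrum_mul_band_le Ω
    _ = 8 * d ^ 2 * (bdry Ω).ncard := by ring

/-- Away from the momenta close to `0`, the power spectrum of an indicator function carries a
weight proportional to the size of the boundary. -/
theorem ncard_bdry_le_sum_indicatorSpectrum (hd : 1 ≤ d) (hL : 3 ≤ L) (Ω : Set (Lam d L)) :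
    ((bdry Ω).ncard : ℝ) ≤ 32 * d ^ 2 * ∑ q, indicatorSpectrum Ω q *
      if ∃ ν, (ZMod.stdAddChar (q ν) : ℂ).re ≤ 1 - 1 / (8 * (d : ℝ) ^ 2) then 1 else 0 := by
  have hd' : (1 : ℝ) ≤ d := by exact_mod_cast hd
  have key : ∀ q : Lam d L, band 0 q ^ 2 - band 0 q / (4 * d) ≤ 16 * d ^ 2 *
      if ∃ ν, (ZMod.stdAddChar (q ν) : ℂ).re ≤ 1 - 1 / (8 * (d : ℝ) ^ 2) then 1 else 0 := by
    intro q
    have h0 := band_zero_nonneg q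
    have h4 := band_zero_le q
    split_ifs with h
    · have : 0 ≤ band 0 q / (4 * d) := by positivity
      nlinarith
    · push Not at h
      have hb : band 0 q ≤ 1 / (4 * d) := by
        rw [band_zero_eq_sum]
        have : ∀ ν ∈ Finset.univ, ‖1 - (ZMod.stdAddChar (q ν) : ℂ)‖ ^ 2 ≤
            1 / (4 * (d : ℝ) ^ 2) := by
          intro ν _
          rw [norm_one_sub_stdAddChar_sq]
          have e : 1 / (4 * (d : ℝ) ^ 2) = 2 * (1 / (8 * (d : ℝ) ^ 2)) := by
            field_simp
            norm_num
          rw [e]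
          linarith [h ν]
        refine (Finset.sum_le_sum this).trans_eq ?_
        rw [Finset.sum_const, Finset.card_univ, Fintype.card_fin, nsmul_eq_mul]
        field_simp
      rw [mul_zero, sub_nonpos, sq]
      calc band 0 q * band 0 q ≤ band 0 q * (1 / (4 * d)) := by gcongr
        _ = band 0 q / (4 * d) := by ring
  have h1 := sum_indicatorSpectrum_mul_band_le Ω
  have h2 := ncard_bdry_le_sum hL Ω
  have h3 : ∑ q, indicatorSpectrum Ω q * (band 0 q ^ 2 - band 0 q / (4 * d)) ≤
      16 * d ^ 2 * ∑ q, indicatorSpectrum Ω q *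
        if ∃ ν, (ZMod.stdAddChar (q ν) : ℂ).re ≤ 1 - 1 / (8 * (d : ℝ) ^ 2) then 1 else 0 := by
    rw [Finset.mul_sum]
    refine Finset.sum_le_sum fun q _ => ?_
    rw [mul_left_comm]
    exact mul_le_mul_of_nonneg_left (key q) (indicatorSpectrum_nonneg Ω q)
  have h4 : ∑ q, indicatorSpectrum Ω q * (band 0 q ^ 2 - band 0 q / (4 * d)) =
      ∑ q, indicatorSpectrum Ω q * band 0 q ^ 2 -
        (∑ q, indicatorSpectrum Ω q * band 0 q) / (4 * d) := by
    rw [Finset.sum_div, ← Finset.sum_sub_distrib]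
    refine Finset.sum_congr rfl fun q _ => ?_
    ring
  have h5 : (∑ q, indicatorSpectrum Ω q * band 0 q) / (4 * d) ≤ (bdry Ω).ncard / 2 := by
    rw [div_le_div_iff₀ (by positivity) two_pos]
    linarith
  linarith

theorem le_sum_coupling {μ c : ℝ} (hd : 1 ≤ d) (hL : 3 ≤ L) (hc : 0 ≤ c)
    (h : ∀ q : Lam d L, (∃ ν, (ZMod.stdAddChar (q ν) : ℂ).re ≤ 1 - 1 / (8 * (d : ℝ) ^ 2)) →
      c * (L : ℝ) ^ d ≤ ∑ k, max (band μ k) 0 * max (-band μ (k - q)) 0)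
    (Ω : Set (Lam d L)) :
    c / (32 * d ^ 2) * (bdry Ω).ncard ≤
      ∑ k, ∑ l, max (band μ k) 0 * max (-band μ l) 0 *
        ‖((fourierMatrix d L)ᴴ * proj Ω * fourierMatrix d L) k l‖ ^ 2 := by
  have hd' : (1 : ℝ) ≤ d := by exact_mod_cast hd
  have hLd : (0 : ℝ) < (L : ℝ) ^ d := pow_pos (Nat.cast_pos.2 (NeZero.pos L)) _
  rw [sum_mul_norm_sq_proj_fourier Ω fun k l => max (band μ k) 0 * max (-band μ l) 0]
  have h1 : ∀ q : Lam d L, c * (L : ℝ) ^ d *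
      (if ∃ ν, (ZMod.stdAddChar (q ν) : ℂ).re ≤ 1 - 1 / (8 * (d : ℝ) ^ 2) then 1 else 0) ≤
      ∑ k, max (band μ k) 0 * max (-band μ (k - q)) 0 := by
    intro q
    split_ifs with hq
    · rw [mul_one]
      exact h q hq
    · rw [mul_zero]
      positivity
  calc c / (32 * d ^ 2) * (bdry Ω).ncard
      ≤ c / (32 * d ^ 2) * (32 * d ^ 2 * ∑ q, indicatorSpectrum Ω q *
        if ∃ ν, (ZMod.stdAddChar (q ν) : ℂ).re ≤ 1 - 1 / (8 * (d : ℝ) ^ 2) then 1 else 0) := by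
        gcongr
        exact ncard_bdry_le_sum_indicatorSpectrum hd hL Ω
    _ = ((L : ℝ) ^ d)⁻¹ * ∑ q, indicatorSpectrum Ω q * (c * (L : ℝ) ^ d *
        if ∃ ν, (ZMod.stdAddChar (q ν) : ℂ).re ≤ 1 - 1 / (8 * (d : ℝ) ^ 2) then 1 else 0) := by
        simp only [mul_left_comm _ (c * (L : ℝ) ^ d), ← Finset.mul_sum]
        rw [← mul_assoc, ← mul_assoc (c * (L : ℝ) ^ d)]
        congr 1
        field_simp
    _ ≤ _ := by
        gcongr with q
        · exact indicatorSpectrum_nonneg Ω q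
        · exact h1 q

omit [NeZero L] in
theorem proj_isHermitian (Ω : Set (Lam d L)) : (proj Ω).IsHermitian := by
  rw [proj, Matrix.IsHermitian, Matrix.diagonal_conjTranspose]
  congr 1
  funext x
  rw [Pi.star_apply]
  split_ifs <;> simp

theorem proj_mul_self (Ω : Set (Lam d L)) : proj Ω * proj Ω = proj Ω := by
  rw [proj, Matrix.diagonal_mul_diagonal]
  congr 1
  funext x
  split_ifs <;> simp

omit [NeZero L] in
theorem proj_compl (Ω : Set (Lam d L)) : proj Ωᶜ = 1 - proj Ω := by
  rw [proj, proj, ← Matrix.diagonal_one, Matrix.diagonal_sub]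
  congr 1
  funext x
  by_cases h : x ∈ Ω <;> simp [h]

theorem neg_pinching_sub_eq (Ω : Set (Lam d L)) (μ : ℝ) :
    -(proj Ω * lap d L * proj Ω + proj Ωᶜ * lap d L * proj Ωᶜ) - (μ : ℂ) • 1 =
      proj Ω * (-(lap d L) - (μ : ℂ) • 1) * proj Ω +
        (1 - proj Ω) * (-(lap d L) - (μ : ℂ) • 1) * (1 - proj Ω) := by
  have h := proj_mul_self Ω
  have h' : (1 - proj Ω) * (1 - proj Ω) = 1 - proj Ω := by
    rw [mul_sub, mul_one, sub_mul, one_mul, h, sub_self, sub_zero]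
  rw [proj_compl]
  simp only [mul_sub, sub_mul (c := proj Ω), sub_mul (c := 1 - proj Ω), mul_neg, neg_mul,
    mul_smul_comm, smul_mul_assoc, mul_one, one_mul, h]
  module

end Boundary

/-- Lemma 3.6 (i): for `1/2 < μ < 4d` there exist a finite length
`L_*(μ)` and `α(μ) > 0` such that for all even `L ≥ L_*(μ)` and all `Ω ⊆ Λ`,
`Tr{[-Δ̃-μ]_-} - Tr{[-Δ-μ]_-} ≥ α(μ)|∂Ω|` with `Δ̃ = P_ΩΔP_Ω + P_Ω^⊥ΔP_Ω^⊥`. -/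
theorem domain_wall_energy_large_mu (d : ℕ) (hd : 1 ≤ d) (μ : ℝ)
    (hμ0 : 1 / 2 < μ) (hμ4 : μ < 4 * d) :
    ∃ (Lstar : ℕ) (α : ℝ), 0 < α ∧
      ∀ (L : ℕ) [NeZero L], Even L → Lstar ≤ L →
        ∀ Ω : Set (Lam d L),
          α * (bdry Ω).ncard ≤
            negTrace (-(proj Ω * lap d L * proj Ω + proj Ωᶜ * lap d L * proj Ωᶜ)
                - (μ : ℂ) • 1)
              - negTrace (-(lap d L) - (μ : ℂ) • 1) := by
  have hd' : (1 : ℝ) ≤ d := by exact_mod_cast hd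
  have hδ1 : 1 / (8 * (d : ℝ) ^ 2) ≤ 1 := by
    rw [div_le_one (by positivity)]
    nlinarith
  obtain ⟨c, L₀, hc, hov⟩ := exists_le_sum_band_overlap hd (by linarith : 0 < μ) hμ4
    (by positivity : (0 : ℝ) < 1 / (8 * (d : ℝ) ^ 2)) hδ1
  refine ⟨max L₀ 3, (c / (32 * d ^ 2)) ^ 2 / (64 * d ^ 3), by positivity, ?_⟩
  intro L _ _ hL Ω
  have hL3 : 3 ≤ L := (le_max_right _ _).trans hL
  have hF := fourierMatrix_conjTranspose_mul_self (d := d) (L := L)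
  have hF' : fourierMatrix d L * (fourierMatrix d L)ᴴ = 1 := mul_eq_one_comm.1 hF
  have hP := proj_isHermitian Ω
  have hPP := proj_mul_self Ω
  rw [neg_pinching_sub_eq]
  obtain ⟨G, hG, hG1, hcomm, hexc⟩ :=
    exists_excess_le_negTrace_sub hP hPP hF (neg_lap_sub_eq_fourier hL3 μ)
  have hQ : ((fourierMatrix d L)ᴴ * proj Ω * fourierMatrix d L).IsHermitian :=
    Matrix.isHermitian_conjTranspose_mul_mul _ hP
  have hQQ : (fourierMatrix d L)ᴴ * proj Ω * fourierMatrix d L *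
      ((fourierMatrix d L)ᴴ * proj Ω * fourierMatrix d L) =
      (fourierMatrix d L)ᴴ * proj Ω * fourierMatrix d L := by
    calc _ = (fourierMatrix d L)ᴴ * proj Ω * (fourierMatrix d L * (fourierMatrix d L)ᴴ) *
          proj Ω * fourierMatrix d L := by simp only [mul_assoc]
      _ = (fourierMatrix d L)ᴴ * (proj Ω * proj Ω) * fourierMatrix d L := by
          rw [hF', mul_one, mul_assoc _ (proj Ω) (proj Ω)]
      _ = _ := by rw [hPP]
  have hsq := sq_coupling_le_excess_mul hQ hQQ hG hG1 hcomm (by positivity : (0 : ℝ) ≤ 4 * d)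
    (abs_band_le (by linarith : 0 ≤ μ) hμ4.le)
  have hS := le_sum_coupling hd hL3 hc.le (hov L ((le_max_left _ _).trans hL)) Ω
  have hN := sum_sq_band_sub_mul_le μ Ω
  have hexc0 : 0 ≤ ∑ k, (band μ k * (G k k).re - min (band μ k) 0) := by
    refine Finset.sum_nonneg fun k _ => ?_
    have h0 : 0 ≤ (G k k).re := (Complex.le_def.1 hG.diag_nonneg).1
    have h1 : (G k k).re ≤ 1 := by
      have := (Complex.le_def.1 (hG1.diag_nonneg (i := k))).1
      simpa using this
    rcases min_cases (band μ k) 0 with h | h <;> nlinarith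
  set K : ℝ := ((bdry Ω).ncard : ℝ)
  have hK0 : 0 ≤ K := Nat.cast_nonneg _
  have hKsq : (c / (32 * d ^ 2) * K) ^ 2 ≤ 64 * d ^ 3 *
      (∑ k, (band μ k * (G k k).re - min (band μ k) 0)) * K := by
    refine (pow_le_pow_left₀ (by positivity) hS 2).trans (hsq.trans ?_)
    refine (mul_le_mul_of_nonneg_left hN (by positivity)).trans_eq ?_
    ring
  refine le_trans ?_ hexc
  rcases hK0.eq_or_lt with h | h
  · rw [← h, mul_zero]
    exact hexc0
  · rw [div_mul_eq_mul_div, div_le_iff₀ (by positivity)]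
    refine le_of_mul_le_mul_right ?_ h
    linarith
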